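/- Let α ∈ (0, 1) and let x : [a, b] → ℝ be absolutely continuous with derivative in L¹, and let y : [a, b] → ℝ be such that I^{1−α}_{b⁻} y is absolutely continuous. Then ∫_a^b y(t) · ᶜD^α_{a⁺} x(t) dt = [x(t) · I^{1−α}_{b⁻} y(t)]_a^b + ∫_a^b x(t) · D^α_{b⁻} y(t) dt, where ᶜD^α_{a⁺} is the left Caputo derivative, D^α_{b⁻} is the right Riemann–Liouville derivative, and I^{1−α}_{b⁻} is the right Riemann–Liouville integral of order 1−α. -/

import Mathlib

open MeasureTheory Set intervalIntegral

/-- The right Riemann–Liouville fractional integral of order `1 - α`. -/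
noncomputable def rlIntRight (α b : ℝ) (y : ℝ → ℝ) (t : ℝ) : ℝ :=
  (1 / Real.Gamma (1 - α)) * ∫ s in t..b, (s - t) ^ (-α) * y s

/-- One-sided power kernel. -/
noncomputable def fker (p u : ℝ) : ℝ := if 0 < u then u ^ (p - 1) else 0

lemma fker_nonneg (p u : ℝ) : 0 ≤ fker p u := by
  unfold fker; split_ifs with h
  · positivity
  · exact le_rfl

lemma fker_measurable (p : ℝ) : Measurable (fker p) :=
  Measurable.ite measurableSet_Ioi (by fun_prop) (by fun_prop)

lemma fker_of_pos {p u : ℝ} (h : 0 < u) : fker p u = u ^ (p - 1) := by simp [fker, h]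

lemma fker_of_nonpos {p u : ℝ} (h : u ≤ 0) : fker p u = 0 := by simp [fker, h.not_gt]

lemma fker_base {p q : ℝ} (hp : 0 < p) (hq : 0 < q) :
    Integrable (fun u => fker p u * fker q (1 - u)) ∧
      0 < ∫ u, fker p u * fker q (1 - u) := by
  have hb := ProbabilityTheory.beta_pos hp hq
  have hnn : ∀ u, 0 ≤ ProbabilityTheory.betaPDFReal p q u := by
    intro u
    by_cases h : 0 < u ∧ u < 1
    · exact (ProbabilityTheory.betaPDFReal_pos h.1 h.2 hp hq).le
    · simp [ProbabilityTheory.betaPDFReal, h]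
  have h1 : ∫⁻ u, ENNReal.ofReal (ProbabilityTheory.betaPDFReal p q u) = 1 :=
    ProbabilityTheory.lintegral_betaPDF_eq_one hp hq
  have hI : Integrable (ProbabilityTheory.betaPDFReal p q) := by
    refine ⟨(ProbabilityTheory.measurable_betaPDFReal p q).aestronglyMeasurable, ?_⟩
    rw [hasFiniteIntegral_iff_ofReal (Filter.Eventually.of_forall hnn), h1]
    exact ENNReal.one_lt_top
  have hV : ∫ u, ProbabilityTheory.betaPDFReal p q u = 1 := by
    rw [integral_eq_lintegral_of_nonneg_ae (Filter.Eventually.of_forall hnn)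
      hI.aestronglyMeasurable, h1]; simp
  have he : (fun u => fker p u * fker q (1 - u)) =
      fun u => ProbabilityTheory.beta p q * ProbabilityTheory.betaPDFReal p q u := by
    funext u
    unfold fker ProbabilityTheory.betaPDFReal
    by_cases h0 : 0 < u <;> by_cases h2 : u < 1 <;> simp [h0, h2]
    field_simp
  rw [he]
  refine ⟨hI.const_mul _, ?_⟩
  rw [MeasureTheory.integral_const_mul, hV]; simpa using hb

lemma fker_beta {p q : ℝ} (hp : 0 < p) (hq : 0 < q) (hpq : p + q = 1) :
    ∃ B : ℝ, 0 < B ∧ ∀ t r : ℝ, Integrable (fun s => fker p (s - t) * fker q (r - s)) ∧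
      ∫ s, fker p (s - t) * fker q (r - s) = (Ioi t).indicator (fun _ => B) r := by
  obtain ⟨hI, hB⟩ := fker_base hp hq
  refine ⟨_, hB, fun t r => ?_⟩
  by_cases h : t < r
  · have hc : 0 < r - t := sub_pos.2 h
    have he : (fun s => fker p (s - t) * fker q (r - s)) = fun s => (r - t)⁻¹ *
        (fun v => (fun u => fker p u * fker q (1 - u)) (v / (r - t))) (s - t) := by
      funext s
      by_cases h1 : 0 < s - t
      · by_cases h2 : 0 < r - s
        · have h3 : 0 < (s - t) / (r - t) := by positivity
          have h4 : 1 - (s - t) / (r - t) = (r - s) / (r - t) := by field_simp; ring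
          have h5 : 0 < (r - s) / (r - t) := by positivity
          simp only [h4, fker_of_pos h1, fker_of_pos h2, fker_of_pos h3, fker_of_pos h5]
          rw [Real.div_rpow h1.le hc.le, Real.div_rpow h2.le hc.le]
          have h6 : (r - t) ^ (p - 1) * (r - t) ^ (q - 1) = (r - t)⁻¹ := by
            rw [← Real.rpow_add hc, ← Real.rpow_neg_one]; congr 1; linarith
          rw [div_mul_div_comm, h6]
          field_simp
        · have h4 : 1 - (s - t) / (r - t) ≤ 0 := by
            rw [sub_nonpos, le_div_iff₀ hc]; linarith
          simp only [fker_of_nonpos (not_lt.1 h2), fker_of_nonpos h4, mul_zero]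
      · have h4 : (s - t) / (r - t) ≤ 0 := div_nonpos_of_nonpos_of_nonneg (not_lt.1 h1) hc.le
        simp only [fker_of_nonpos (not_lt.1 h1), fker_of_nonpos h4, mul_zero, zero_mul]
    rw [he]
    refine ⟨((hI.comp_div hc.ne').comp_sub_right t).const_mul _, ?_⟩
    rw [MeasureTheory.integral_const_mul, integral_sub_right_eq_self (fun v => (fun u => fker p u * fker q (1 - u)) (v / (r - t))) t,
      Measure.integral_comp_div (fun u => fker p u * fker q (1 - u)), indicator_of_mem (by exact h), abs_of_pos hc, smul_eq_mul]
    field_simp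
  · have he : (fun s => fker p (s - t) * fker q (r - s)) = fun s => 0 := by
      funext s
      by_cases h1 : 0 < s - t
      · rw [fker_of_nonpos (u := r - s) (by linarith), mul_zero]
      · rw [fker_of_nonpos (not_lt.1 h1), zero_mul]
    rw [he]
    refine ⟨integrable_zero _ _ _, ?_⟩
    rw [MeasureTheory.integral_zero, indicator_of_notMem (by exact h)]

/-- The semigroup law for the kernels, for all base points. -/
lemma fker_comp {p q : ℝ} (hp : 0 < p) (hq : 0 < q) (hpq : p + q = 1) :
    ∃ B : ℝ, 0 < B ∧ ∀ F : ℝ → ℝ, Integrable F → ∀ t : ℝ,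
      Integrable (fun z : ℝ × ℝ => fker p (z.1 - t) * (fker q (z.2 - z.1) * F z.2))
        (volume.prod volume) ∧
      ∫ s, fker p (s - t) * ∫ r, fker q (r - s) * F r = B * ∫ r in Ioi t, F r := by
  obtain ⟨B, hB, hk⟩ := fker_beta hp hq hpq
  refine ⟨B, hB, fun F hF t => ?_⟩
  have hm : AEStronglyMeasurable
      (fun z : ℝ × ℝ => fker p (z.1 - t) * (fker q (z.2 - z.1) * F z.2))
        (volume.prod volume) := by
    refine AEStronglyMeasurable.mul ?_ (AEStronglyMeasurable.mul ?_ hF.aestronglyMeasurable.comp_snd)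
    · exact ((fker_measurable p).comp (by fun_prop)).aestronglyMeasurable
    · exact ((fker_measurable q).comp (by fun_prop)).aestronglyMeasurable
  have hint : Integrable (fun z : ℝ × ℝ => fker p (z.1 - t) * (fker q (z.2 - z.1) * F z.2))
        (volume.prod volume) := by
    rw [integrable_prod_iff' hm]
    constructor
    · refine Filter.Eventually.of_forall fun r => ?_
      simpa only [mul_assoc] using (hk t r).1.mul_const (F r)
    · have he : (fun r => ∫ s, ‖fker p (s - t) * (fker q (r - s) * F r)‖) =
          (Ioi t).indicator (fun r => B * ‖F r‖) := by
        funext r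
        have : ∀ s, ‖fker p (s - t) * (fker q (r - s) * F r)‖ =
            fker p (s - t) * fker q (r - s) * ‖F r‖ := fun s => by
          rw [norm_mul, norm_mul, Real.norm_of_nonneg (fker_nonneg _ _),
            Real.norm_of_nonneg (fker_nonneg _ _), mul_assoc]
        simp_rw [this]
        rw [MeasureTheory.integral_mul_const, (hk t r).2]
        by_cases h : r ∈ Ioi t <;> simp [h, -mem_Ioi]
      simp only [he]
      exact (hF.norm.const_mul B).indicator measurableSet_Ioi
  refine ⟨hint, ?_⟩
  calc _ = ∫ s, ∫ r, fker p (s - t) * (fker q (r - s) * F r) := by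
        simp_rw [MeasureTheory.integral_const_mul]
    _ = ∫ r, ∫ s, fker p (s - t) * (fker q (r - s) * F r) := integral_integral_swap hint
    _ = ∫ r, B * (Ioi t).indicator F r := by
        congr 1; funext r
        simp_rw [← mul_assoc]
        rw [MeasureTheory.integral_mul_const, (hk t r).2]
        by_cases h : r ∈ Ioi t <;> simp [h, -mem_Ioi]
    _ = _ := by rw [MeasureTheory.integral_const_mul, MeasureTheory.integral_indicator measurableSet_Ioi]

lemma ae_zero_of_tails {z : ℝ → ℝ} (hz : Integrable z) (h : ∀ t, ∫ r in Ioi t, z r = 0) :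
    z =ᵐ[volume] 0 := by
  filter_upwards [LocallyIntegrable.ae_hasDerivAt_integral hz.locallyIntegrable] with u hu
  have h0 : (fun v => ∫ t in (0:ℝ)..v, z t) = fun _ => 0 := by
    funext v
    rw [← integral_Ioi_sub_Ioi' hz.integrableOn hz.integrableOn, h, h, sub_zero]
  have := hu 0
  rw [h0] at this
  exact this.unique (hasDerivAt_const u 0)

lemma fker_inner_integrable {p q : ℝ} {F : ℝ → ℝ} {t : ℝ}
    (h : Integrable (fun z : ℝ × ℝ => fker p (z.1 - t) * (fker q (z.2 - z.1) * F z.2))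
        (volume.prod volume)) :
    Integrable (fun s => fker p (s - t) * ∫ r, fker q (r - s) * F r) := by
  have := h.integral_prod_left
  simpa only [MeasureTheory.integral_const_mul] using this

/-- Inversion of Abel's equation. -/
lemma abel_inversion {p q a b G : ℝ} (hp : 0 < p) (hq : 0 < q) (hpq : p + q = 1) (hab : a < b)
    {Y D : ℝ → ℝ} (hY : Integrable Y) (hD : Integrable D) (hYa : ∀ t ≤ a, Y t = 0)
    (hDb : ∀ t, b < t → D t = 0)
    (h : ∀ t, a < t → ∫ s, fker p (s - t) * Y s = G * ∫ r in Ioi t, D r) :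
    ∃ C : ℝ, ∀ᵐ t, Y t = C * (Ioi a).indicator (fun t => ∫ r, fker q (r - t) * D r) t := by
  obtain ⟨B, hB, hcomp⟩ := fker_comp hp hq hpq
  obtain ⟨B', hB', hcomp'⟩ := fker_comp hq hp (by linarith)
  set w : ℝ → ℝ := (Ioi a).indicator (fun t => ∫ r, fker q (r - t) * D r) with hw
  have hwint : Integrable w := by
    have h1 := fker_inner_integrable (hcomp D hD a).1
    have hm : AEStronglyMeasurable w := by
      refine AEStronglyMeasurable.indicator ?_ measurableSet_Ioi
      have : AEStronglyMeasurable (fun z : ℝ × ℝ => fker q (z.2 - z.1) * D z.2)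
          (volume.prod volume) := AEStronglyMeasurable.mul
        ((fker_measurable q).comp (by fun_prop)).aestronglyMeasurable
        hD.aestronglyMeasurable.comp_snd
      exact this.integral_prod_right'
    refine (h1.norm.const_mul ((b - a) ^ (1 - p))).mono' hm (Filter.Eventually.of_forall fun s => ?_)
    rw [hw]
    by_cases hs : a < s
    · rw [indicator_of_mem (by exact hs), norm_mul, Real.norm_of_nonneg (fker_nonneg _ _),
        ← mul_assoc]
      by_cases hsb : s < b
      · refine le_mul_of_one_le_left (norm_nonneg _) ?_
        rw [fker_of_pos (sub_pos.2 hs)]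
        calc (1:ℝ) = (b - a) ^ (1 - p) * (b - a) ^ (p - 1) := by
              rw [← Real.rpow_add (sub_pos.2 hab)]; simp
          _ ≤ _ := by
              refine mul_le_mul_of_nonneg_left ?_ (Real.rpow_nonneg (sub_pos.2 hab).le _)
              exact Real.rpow_le_rpow_of_nonpos (sub_pos.2 hs) (by linarith) (by linarith)
      · have : (fun r => fker q (r - s) * D r) = fun _ => 0 := by
          funext r
          by_cases hr : b < r
          · rw [hDb r hr, mul_zero]
          · rw [fker_of_nonpos (by linarith), zero_mul]
        simp [this]
    · rw [indicator_of_notMem (by exact hs), norm_zero]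
      have := Real.rpow_nonneg (sub_pos.2 hab).le (1 - p)
      positivity
  have hkw : ∀ t, a < t → (fun s => fker p (s - t) * w s) =
      fun s => fker p (s - t) * ∫ r, fker q (r - s) * D r := by
    intro t ht; funext s
    by_cases hs : a < s
    · rw [hw, indicator_of_mem (by exact hs)]
    · rw [fker_of_nonpos (by linarith), zero_mul, zero_mul]
  let z : ℝ → ℝ := fun s => B * Y s - G * w s
  have hz : Integrable z := (hY.const_mul B).sub (hwint.const_mul G)
  have hza : ∀ t ≤ a, z t = 0 := by
    intro t ht
    simp only [z, hYa t ht, hw]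
    rw [indicator_of_notMem (by simpa using ht)]; simp
  have hKz : ∀ᵐ t, a < t → ∫ s, fker p (s - t) * z s = 0 := by
    filter_upwards [(hcomp' Y hY a).1.prod_right_ae] with t ht hat
    have hne : fker q (t - a) ≠ 0 := by
      rw [fker_of_pos (sub_pos.2 hat)]
      exact (Real.rpow_pos_of_pos (sub_pos.2 hat) _).ne'
    have h1 : Integrable (fun s => fker p (s - t) * Y s) := by
      have := ht.const_mul (fker q (t - a))⁻¹
      refine this.congr (Filter.Eventually.of_forall fun s => ?_)
      simp only
      rw [← mul_assoc, inv_mul_cancel₀ hne, one_mul]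
    have h2 : Integrable (fun s => fker p (s - t) * w s) := by
      rw [hkw t hat]; exact fker_inner_integrable (hcomp D hD t).1
    have he : (fun s => fker p (s - t) * z s) =
        fun s => B * (fker p (s - t) * Y s) - G * (fker p (s - t) * w s) := by
      funext s; simp only [z]; ring
    rw [he, MeasureTheory.integral_sub (h1.const_mul _) (h2.const_mul _),
      MeasureTheory.integral_const_mul, MeasureTheory.integral_const_mul, h t hat, hkw t hat,
      (hcomp D hD t).2]
    ring
  have htail : ∀ t, a ≤ t → ∫ r in Ioi t, z r = 0 := by
    intro t hat
    have h1 := (hcomp' z hz t).2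
    have h2 : ∫ s, fker q (s - t) * ∫ r, fker p (r - s) * z r = 0 := by
      refine integral_eq_zero_of_ae ?_
      filter_upwards [hKz] with s hs
      by_cases hts : t < s
      · simp [hs (by linarith)]
      · simp [fker_of_nonpos (p := q) (u := s - t) (by linarith)]
    rw [h2] at h1
    rcases mul_eq_zero.1 h1.symm with h3 | h3
    · exact absurd h3 hB'.ne'
    · exact h3
  have hz0 : z =ᵐ[volume] 0 := by
    refine ae_zero_of_tails hz fun t => ?_
    by_cases hat : a ≤ t
    · exact htail t hat
    · rw [← htail a le_rfl]
      refine (setIntegral_eq_of_subset_of_forall_sdiff_eq_zero measurableSet_Ioi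
        (Ioi_subset_Ioi (by linarith)) ?_)
      intro s hs
      exact hza s (not_lt.1 hs.2)
  refine ⟨G / B, ?_⟩
  filter_upwards [hz0] with t ht
  have : B * Y t - G * w t = 0 := ht
  field_simp
  linarith

lemma kernel_swap {p q a b G : ℝ} (hp : 0 < p) (hq : 0 < q) (hpq : p + q = 1) (hab : a < b)
    {X Y D : ℝ → ℝ} (hX : Integrable X) (hY : Integrable Y) (hD : Integrable D)
    (hXa : ∀ t ≤ a, X t = 0) (hYa : ∀ t ≤ a, Y t = 0)
    (hDb : ∀ t, b < t → D t = 0)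
    (h : ∀ t, a < t → ∫ s, fker p (s - t) * Y s = G * ∫ r in Ioi t, D r) :
    ∫ t, Y t * ∫ s, fker p (t - s) * X s = G * ∫ s, X s * ∫ r in Ioi s, D r := by
  obtain ⟨C, hC⟩ := abel_inversion hp hq hpq hab hY hD hYa hDb h
  obtain ⟨B, hB, hcomp⟩ := fker_comp hp hq hpq
  have hm : AEStronglyMeasurable
      (fun z : ℝ × ℝ => Y z.1 * (fker p (z.1 - z.2) * X z.2)) (volume.prod volume) := by
    refine AEStronglyMeasurable.mul hY.aestronglyMeasurable.comp_fst
      (AEStronglyMeasurable.mul ?_ hX.aestronglyMeasurable.comp_snd)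
    exact ((fker_measurable p).comp (by fun_prop)).aestronglyMeasurable
  have hkY : ∀ s, a < s → Integrable (fun t => fker p (t - s) * Y t) := by
    intro s hs
    refine ((fker_inner_integrable (hcomp D hD s).1).const_mul C).congr ?_
    filter_upwards [hC] with t ht
    by_cases hat : a < t
    · rw [ht, indicator_of_mem (by exact hat)]; ring
    · rw [fker_of_nonpos (by linarith)]; ring
  have hbound : ∀ s, a < s → ∫ t, ‖fker p (t - s) * Y t‖ ≤ |C| * (B * ∫ r, ‖D r‖) := by
    intro s hs
    have hDn := hcomp (fun r => ‖D r‖) hD.norm s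
    calc ∫ t, ‖fker p (t - s) * Y t‖
        ≤ ∫ t, |C| * (fker p (t - s) * ∫ r, fker q (r - t) * ‖D r‖) := by
          refine integral_mono_ae (hkY s hs).norm ((fker_inner_integrable hDn.1).const_mul _) ?_
          filter_upwards [hC] with t ht
          by_cases hat : a < t
          · rw [ht, indicator_of_mem (by exact hat), norm_mul, norm_mul,
              Real.norm_of_nonneg (fker_nonneg _ _), Real.norm_eq_abs C, mul_left_comm]
            refine mul_le_mul_of_nonneg_left (mul_le_mul_of_nonneg_left ?_ (fker_nonneg _ _))
              (abs_nonneg _)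
            refine (MeasureTheory.norm_integral_le_integral_norm _).trans (le_of_eq ?_)
            congr 1; funext r
            rw [norm_mul, Real.norm_of_nonneg (fker_nonneg _ _)]
          · rw [fker_of_nonpos (by linarith)]; simp
      _ = |C| * (B * ∫ r in Ioi s, ‖D r‖) := by rw [MeasureTheory.integral_const_mul, hDn.2]
      _ ≤ _ := by
          refine mul_le_mul_of_nonneg_left (mul_le_mul_of_nonneg_left ?_ hB.le) (abs_nonneg _)
          exact setIntegral_le_integral hD.norm (Filter.Eventually.of_forall fun r => norm_nonneg _)
  have hint : Integrable (fun z : ℝ × ℝ => Y z.1 * (fker p (z.1 - z.2) * X z.2))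
      (volume.prod volume) := by
    rw [integrable_prod_iff' hm]
    constructor
    · refine Filter.Eventually.of_forall fun s => ?_
      by_cases hs : a < s
      · refine ((hkY s hs).mul_const (X s)).congr (Filter.Eventually.of_forall fun t => ?_)
        simp only; ring
      · simp [hXa s (by linarith)]
    · refine (hX.norm.const_mul (|C| * (B * ∫ r, ‖D r‖))).mono'
        hm.norm.prod_swap.integral_prod_right' (Filter.Eventually.of_forall fun s => ?_)
      by_cases hs : a < s
      · have he : ∀ t, ‖Y t * (fker p (t - s) * X s)‖ = ‖fker p (t - s) * Y t‖ * ‖X s‖ := by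
          intro t; rw [← norm_mul]; congr 1; ring
        simp only [he]
        rw [MeasureTheory.integral_mul_const, norm_mul, norm_norm,
          Real.norm_of_nonneg (integral_nonneg fun t => norm_nonneg _)]
        exact mul_le_mul_of_nonneg_right (hbound s hs) (norm_nonneg _)
      · simp [hXa s (by linarith)]
  calc ∫ t, Y t * ∫ s, fker p (t - s) * X s
      = ∫ t, ∫ s, Y t * (fker p (t - s) * X s) := by simp_rw [MeasureTheory.integral_const_mul]
    _ = ∫ s, ∫ t, Y t * (fker p (t - s) * X s) := integral_integral_swap hint
    _ = ∫ s, G * (X s * ∫ r in Ioi s, D r) := by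
        congr 1; funext s
        have he : ∀ t, Y t * (fker p (t - s) * X s) = X s * (fker p (t - s) * Y t) := by
          intro t; ring
        simp_rw [he]
        rw [MeasureTheory.integral_const_mul]
        by_cases hs : a < s
        · rw [h s hs]; ring
        · rw [hXa s (by linarith)]; ring
    _ = _ := by rw [MeasureTheory.integral_const_mul]

lemma triangle_swap {X D : ℝ → ℝ} (hX : Integrable X) (hD : Integrable D) :
    Integrable (fun t => D t * ∫ s in Iio t, X s) ∧
    ∫ s, X s * ∫ t in Ioi s, D t = ∫ t, D t * ∫ s in Iio t, X s := by
  have hS : MeasurableSet {z : ℝ × ℝ | z.2 < z.1} :=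
    measurableSet_lt measurable_snd measurable_fst
  have hint := (hD.mul_prod hX).indicator hS
  have e1 : ∀ t s : ℝ, ({z : ℝ × ℝ | z.2 < z.1}.indicator (fun z => D z.1 * X z.2)) (t, s) =
      D t * (Iio t).indicator X s := by
    intro t s
    by_cases h : s < t <;> simp [indicator, h]
  have e2 : ∀ t s : ℝ, ({z : ℝ × ℝ | z.2 < z.1}.indicator (fun z => D z.1 * X z.2)) (t, s) =
      X s * (Ioi s).indicator D t := by
    intro t s
    by_cases h : s < t <;> simp [indicator, h, mul_comm]
  have i1 : ∀ t, ∫ s, ({z : ℝ × ℝ | z.2 < z.1}.indicator (fun z => D z.1 * X z.2)) (t, s) =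
      D t * ∫ s in Iio t, X s := by
    intro t
    simp_rw [e1]
    rw [MeasureTheory.integral_const_mul, MeasureTheory.integral_indicator measurableSet_Iio]
  have i2 : ∀ s, ∫ t, ({z : ℝ × ℝ | z.2 < z.1}.indicator (fun z => D z.1 * X z.2)) (t, s) =
      X s * ∫ t in Ioi s, D t := by
    intro s
    simp_rw [e2]
    rw [MeasureTheory.integral_const_mul, MeasureTheory.integral_indicator measurableSet_Ioi]
  constructor
  · have := hint.integral_prod_left
    simpa only [i1] using this
  · have := integral_integral_swap (f := fun t s =>
      ({z : ℝ × ℝ | z.2 < z.1}.indicator (fun z => D z.1 * X z.2)) (t, s)) hint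
    simp_rw [i1, i2] at this
    exact this.symm

/-- Fractional integration by parts (Lemma 1, scalar case):
`x` is absolutely continuous with derivative `x' ∈ L¹`, and
`I^{1-α}_{b⁻} y` is absolutely continuous with derivative `-Dy` in `L¹`,
where `Dy = D^α_{b⁻} y` is the right Riemann–Liouville derivative. -/
theorem fractional_integration_by_parts (a b α : ℝ) (hab : a < b)
    (hα : α ∈ Ioo (0 : ℝ) 1) (x x' y Dy : ℝ → ℝ)
    (hx' : IntervalIntegrable x' volume a b)
    (hxAC : ∀ t ∈ Icc a b, x t = x a + ∫ s in a..t, x' s)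
    (hy : IntervalIntegrable y volume a b)
    (hDy : IntervalIntegrable Dy volume a b)
    (hyD : ∀ t ∈ Ioo a b, HasDerivAt (rlIntRight α b y) (-(Dy t)) t)
    (hyAC : ∀ t ∈ Icc a b,
      rlIntRight α b y t = rlIntRight α b y a - ∫ s in a..t, Dy s) :
    (∫ t in a..b,
        y t * ((1 / Real.Gamma (1 - α)) * ∫ s in a..t, (t - s) ^ (-α) * x' s))
      = (x b * rlIntRight α b y b - x a * rlIntRight α b y a)
        + ∫ t in a..b, x t * Dy t := by
  obtain ⟨hα0, hα1⟩ := hα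
  have hG : 0 < Real.Gamma (1 - α) := Real.Gamma_pos_of_pos (by linarith)
  have hX : Integrable ((Ioc a b).indicator x') :=
    ((intervalIntegrable_iff_integrableOn_Ioc_of_le hab.le).1 hx').integrable_indicator
      measurableSet_Ioc
  have hY : Integrable ((Ioc a b).indicator y) :=
    ((intervalIntegrable_iff_integrableOn_Ioc_of_le hab.le).1 hy).integrable_indicator
      measurableSet_Ioc
  have hD : Integrable ((Ioc a b).indicator Dy) :=
    ((intervalIntegrable_iff_integrableOn_Ioc_of_le hab.le).1 hDy).integrable_indicator
      measurableSet_Ioc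
  set X := (Ioc a b).indicator x' with hXdef
  set Y := (Ioc a b).indicator y with hYdef
  set D := (Ioc a b).indicator Dy with hDdef
  have hgb : rlIntRight α b y b = 0 := by simp [rlIntRight]
  have hga : rlIntRight α b y a = ∫ s in a..b, Dy s := by
    have := hyAC b ⟨hab.le, le_rfl⟩
    rw [hgb] at this; linarith
  -- tails of D
  have hDtail : ∀ t, a ≤ t → t ≤ b → ∫ r in Ioi t, D r = ∫ r in t..b, Dy r := by
    intro t h1 h2
    rw [intervalIntegral.integral_of_le h2, hDdef, setIntegral_indicator measurableSet_Ioc]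
    congr 2
    ext r; simp only [mem_inter_iff, mem_Ioi, mem_Ioc]
    constructor
    · rintro ⟨h3, _, h4⟩; exact ⟨h3, h4⟩
    · rintro ⟨h3, h4⟩; exact ⟨h3, by linarith, h4⟩
  have hkY : ∀ t, a ≤ t → t ≤ b → ∫ s, fker (1 - α) (s - t) * Y s =
      ∫ s in t..b, (s - t) ^ (-α) * y s := by
    intro t h1 h2
    rw [intervalIntegral.integral_of_le h2, ← MeasureTheory.integral_indicator measurableSet_Ioc]
    congr 1; funext s
    by_cases h3 : t < s
    · rw [fker_of_pos (sub_pos.2 h3)]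
      by_cases h4 : s ≤ b
      · rw [hYdef, indicator_of_mem (show s ∈ Ioc a b from ⟨by linarith, h4⟩),
          indicator_of_mem (show s ∈ Ioc t b from ⟨h3, h4⟩)]
        congr 2; ring
      · rw [hYdef, indicator_of_notMem (fun h => h4 h.2), indicator_of_notMem (fun h => h4 h.2),
          mul_zero]
    · rw [fker_of_nonpos (by linarith), zero_mul, indicator_of_notMem (fun h => h3 h.1)]
  have hkX : ∀ t, a ≤ t → t ≤ b → ∫ s, fker (1 - α) (t - s) * X s =
      ∫ s in a..t, (t - s) ^ (-α) * x' s := by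
    intro t h1 h2
    rw [intervalIntegral.integral_of_le h1, integral_Ioc_eq_integral_Ioo,
      ← MeasureTheory.integral_indicator measurableSet_Ioo]
    congr 1; funext s
    by_cases h3 : s < t
    · rw [fker_of_pos (sub_pos.2 h3)]
      by_cases h4 : a < s
      · rw [hXdef, indicator_of_mem (show s ∈ Ioc a b from ⟨h4, by linarith⟩),
          indicator_of_mem (show s ∈ Ioo a t from ⟨h4, h3⟩)]
        congr 2; ring
      · rw [hXdef, indicator_of_notMem (fun h => h4 h.1), indicator_of_notMem (fun h => h4 h.1),
          mul_zero]
    · rw [fker_of_nonpos (by linarith), zero_mul, indicator_of_notMem (fun h => h3 h.2)]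
  have hXhead : ∀ t, a < t → t ≤ b → ∫ s in Iio t, X s = x t - x a := by
    intro t h1 h2
    rw [hxAC t ⟨h1.le, h2⟩, intervalIntegral.integral_of_le h1.le, integral_Ioc_eq_integral_Ioo,
      hXdef, setIntegral_indicator measurableSet_Ioc, add_sub_cancel_left]
    congr 2
    ext r; simp only [mem_inter_iff, mem_Iio, mem_Ioc, mem_Ioo]
    constructor
    · rintro ⟨h3, h4, _⟩; exact ⟨h4, h3⟩
    · rintro ⟨h3, h4⟩; exact ⟨h4, h3, by linarith⟩
  have habel : ∀ t, a < t → ∫ s, fker (1 - α) (s - t) * Y s =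
      Real.Gamma (1 - α) * ∫ r in Ioi t, D r := by
    intro t hat
    by_cases htb : t ≤ b
    · rw [hkY t hat.le htb, hDtail t hat.le htb]
      have h1 := hyAC t ⟨hat.le, htb⟩
      have hmt : t ∈ uIcc a b := by rw [uIcc_of_le hab.le]; exact ⟨hat.le, htb⟩
      have h2 := intervalIntegral.integral_add_adjacent_intervals
        (hDy.mono_set (uIcc_subset_uIcc left_mem_uIcc hmt))
        (hDy.mono_set (uIcc_subset_uIcc hmt right_mem_uIcc))
      rw [hga, ← h2, add_sub_cancel_left] at h1
      rw [← h1, rlIntRight]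
      field_simp
    · have e1 : ∀ s, fker (1 - α) (s - t) * Y s = 0 := by
        intro s
        by_cases hs : t < s
        · rw [hYdef, indicator_of_notMem (fun h => by have := h.2; linarith), mul_zero]
        · rw [fker_of_nonpos (by linarith), zero_mul]
      have e2 : ∫ r in Ioi t, D r = 0 := by
        refine setIntegral_eq_zero_of_forall_eq_zero fun r hr => ?_
        have hr' : t < r := hr
        rw [hDdef, indicator_of_notMem (fun h => by have := h.2; linarith)]
      simp [e1, e2]
  have hmain := kernel_swap (p := 1 - α) (q := α) (by linarith) hα0 (by ring) hab hX hY hD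
    (fun t ht => indicator_of_notMem (fun h => by have := h.1; linarith) _)
    (fun t ht => indicator_of_notMem (fun h => by have := h.1; linarith) _)
    (fun t ht => indicator_of_notMem (fun h => by have := h.2; linarith) _) habel
  obtain ⟨htI, htri⟩ := triangle_swap hX hD
  rw [htri] at hmain
  have hL : (∫ t in a..b,
        y t * ((1 / Real.Gamma (1 - α)) * ∫ s in a..t, (t - s) ^ (-α) * x' s)) =
      (1 / Real.Gamma (1 - α)) * ∫ t, Y t * ∫ s, fker (1 - α) (t - s) * X s := by
    rw [intervalIntegral.integral_of_le hab.le, ← MeasureTheory.integral_indicator measurableSet_Ioc,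
      ← MeasureTheory.integral_const_mul]
    congr 1; funext t
    by_cases ht : t ∈ Ioc a b
    · rw [indicator_of_mem ht, hYdef, indicator_of_mem ht, hkX t ht.1.le ht.2]; ring
    · rw [indicator_of_notMem ht, hYdef, indicator_of_notMem ht]; ring
  have hR : ∫ t in a..b, x t * Dy t =
      (∫ t, D t * ∫ s in Iio t, X s) + x a * ∫ t in a..b, Dy t := by
    rw [intervalIntegral.integral_of_le hab.le, intervalIntegral.integral_of_le hab.le,
      ← MeasureTheory.integral_indicator measurableSet_Ioc, ← MeasureTheory.integral_indicator measurableSet_Ioc,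
      ← MeasureTheory.integral_const_mul, ← MeasureTheory.integral_add htI (hD.const_mul _)]
    congr 1; funext t
    by_cases ht : t ∈ Ioc a b
    · rw [indicator_of_mem ht, hDdef, indicator_of_mem ht, hXhead t ht.1 ht.2]; ring
    · rw [indicator_of_notMem ht, hDdef, indicator_of_notMem ht]; ring
  rw [hL, hmain, hR, hgb, hga]
  field_simp
  ring
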